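/- Let (X,G,α) be a topological dynamical system and H ≤ G a subgroup of finite index. Then the maximal pattern entropy of the G-action equals the maximal pattern entropy of the restricted H-action: h*_{top}(X,G,α) = h*_{top}(X,H,α|_H). -/

import Mathlib

open Filter Topology Set
open scoped ENNReal Classical

section EntropyDefs

variable {G X : Type*}

/-- `𝒰` is an open cover of `X`. -/
def IsOpenCover [TopologicalSpace X] (𝒰 : Set (Set X)) : Prop :=
  (∀ U ∈ 𝒰, IsOpen U) ∧ ⋃₀ 𝒰 = Set.univ

/-- `N(𝒰)`: the minimal cardinality of a finite subcover of `𝒰`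
(junk value `0` if no finite subcover exists). -/
noncomputable def coverN (𝒰 : Set (Set X)) : ℕ :=
  sInf {n : ℕ | ∃ F : Finset (Set X), ↑F ⊆ 𝒰 ∧ F.card = n ∧ ⋃₀ (F : Set (Set X)) = Set.univ}

/-- The join `⋁_{i=1}^n α_{g_i⁻¹}(𝒰)` of the covers `α_{g_i⁻¹}(𝒰) = (α g_i)⁻¹'(𝒰)`. -/
def joinPull (α : G → X → X) (𝒰 : Set (Set X)) {n : ℕ} (g : Fin n → G) : Set (Set X) :=
  {V | ∃ U : Fin n → Set X, (∀ i, U i ∈ 𝒰) ∧ V = ⋂ i, α (g i) ⁻¹' U i}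

/-- Topological sequence entropy of the cover `𝒰` along the sequence `𝔰`:
`h_top^𝔰(𝒰,G) = limsup_n (1/n) log N(⋁_{i=1}^n α_{𝔰(i)⁻¹}(𝒰))`, valued in `[0,∞]`. -/
noncomputable def seqEntCover (α : G → X → X) (𝔰 : ℕ → G) (𝒰 : Set (Set X)) : ℝ≥0∞ :=
  Filter.atTop.limsup fun n : ℕ =>
    ENNReal.ofReal (Real.log (coverN (joinPull α 𝒰 fun i : Fin n => 𝔰 i)) / n)

/-- Topological sequence entropy of the action along `𝔰`: supremum over all open covers. -/
noncomputable def seqEnt [TopologicalSpace X] (α : G → X → X) (𝔰 : ℕ → G) : ℝ≥0∞ :=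
  ⨆ 𝒰 ∈ {𝒰 : Set (Set X) | IsOpenCover 𝒰}, seqEntCover α 𝔰 𝒰

/-- `p*_{X,G,𝒰}(n) = max_{(g_1,…,g_n) ∈ Gⁿ} N(⋁_{i=1}^n α_{g_i⁻¹}(𝒰))`. -/
noncomputable def patN (α : G → X → X) (𝒰 : Set (Set X)) (n : ℕ) : ℕ :=
  sSup {m : ℕ | ∃ g : Fin n → G, m = coverN (joinPull α 𝒰 g)}

/-- Maximal pattern entropy of the cover `𝒰`: `lim_n (1/n) log p*_{X,G,𝒰}(n)`
(the limit exists by subadditivity and coincides with the limsup used here). -/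
noncomputable def patEntCover (α : G → X → X) (𝒰 : Set (Set X)) : ℝ≥0∞ :=
  Filter.atTop.limsup fun n : ℕ => ENNReal.ofReal (Real.log (patN α 𝒰 n) / n)

/-- Maximal pattern entropy `h*_top(X,G)`: supremum over all open covers. -/
noncomputable def patEnt [TopologicalSpace X] (α : G → X → X) : ℝ≥0∞ :=
  ⨆ 𝒰 ∈ {𝒰 : Set (Set X) | IsOpenCover 𝒰}, patEntCover α 𝒰

/-- `α` is an action of `G` on `X` by homeomorphisms. -/
def IsActionBy [Group G] [TopologicalSpace X] (α : G → X → X) : Prop :=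
  (∀ x, α 1 x = x) ∧ (∀ g h x, α (g * h) x = α g (α h x)) ∧ ∀ g, Continuous (α g)

/-- `I ⊆ G` is an independence set for the tuple `(A 1, …, A k)`:
for every nonempty finite `F ⊆ I` and every `ω : F → {1,…,k}` we have
`⋂_{g ∈ F} α_{g⁻¹}(A (ω g)) ≠ ∅`. -/
def IsIndepSet (α : G → X → X) {k : ℕ} (A : Fin k → Set X) (I : Set G) : Prop :=
  ∀ F : Finset G, ↑F ⊆ I → F.Nonempty → ∀ ω : G → Fin k,
    (⋂ g ∈ F, α g ⁻¹' A (ω g)).Nonempty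

/-- The tuple `(A 1, …, A k)` has arbitrarily large finite independence sets. -/
def HasArbLargeIndep (α : G → X → X) {k : ℕ} (A : Fin k → Set X) : Prop :=
  ∀ n : ℕ, ∃ F : Finset G, n ≤ F.card ∧ IsIndepSet α A ↑F

/-- `(x 1, …, x k)` is an IN-tuple: every product neighbourhood has arbitrarily large
finite independence sets. -/
def IsINTuple [TopologicalSpace X] (α : G → X → X) {k : ℕ} (x : Fin k → X) : Prop :=
  ∀ U : Fin k → Set X, (∀ i, IsOpen (U i)) → (∀ i, x i ∈ U i) → HasArbLargeIndep α U

/-- The action `α` of `G` on `X` is (topologically) weak-mixing. -/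
def IsWeakMixing [TopologicalSpace X] (α : G → X → X) : Prop :=
  ∀ U₁ U₂ V₁ V₂ : Set X, IsOpen U₁ → IsOpen U₂ → IsOpen V₁ → IsOpen V₂ →
    U₁.Nonempty → U₂.Nonempty → V₁.Nonempty → V₂.Nonempty →
    ∃ g : G, (U₁ ∩ α g '' V₁).Nonempty ∧ (U₂ ∩ α g '' V₂).Nonempty

/-- `(x₁,x₂)` is a sequence entropy pair. -/
def IsSeqEntropyPair [TopologicalSpace X] (α : G → X → X) (x₁ x₂ : X) : Prop :=
  x₁ ≠ x₂ ∧ ∀ A₁ A₂ : Set X, IsClosed A₁ → IsClosed A₂ →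
    A₁ ∈ nhds x₁ → A₂ ∈ nhds x₂ → Disjoint A₁ A₂ →
    ∃ 𝔰 : ℕ → G, 0 < seqEntCover α 𝔰 {A₁ᶜ, A₂ᶜ}

/-- `(x 1, …, x k)` is a sequence entropy tuple: it is not diagonal, and whenever
`U i` are closed neighbourhoods of the `x i` which coincide on equal coordinates and are
pairwise disjoint on distinct coordinates (i.e. pairwise disjoint closed neighbourhoods of
the distinct points of the tuple), some sequence gives positive sequence entropy for the
cover by their complements. -/
def IsSeqEntropyTuple [TopologicalSpace X] (α : G → X → X) {k : ℕ} (x : Fin k → X) : Prop :=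
  (∃ i j, x i ≠ x j) ∧ ∀ U : Fin k → Set X,
    (∀ i, IsClosed (U i)) → (∀ i, U i ∈ nhds (x i)) →
    (∀ i j, x i = x j → U i = U j) → (∀ i j, x i ≠ x j → Disjoint (U i) (U j)) →
    ∃ 𝔰 : ℕ → G, 0 < seqEntCover α 𝔰 (Set.range fun i => (U i)ᶜ)

end EntropyDefs

namespace CoInd

variable {G : Type*} [Group G] (H : Subgroup G)

/-- `H\G`, the space of right cosets of `H` in `G`. -/
abbrev RQ := Quotient (QuotientGroup.rightRel H)

/-- Right multiplication `Hg ↦ H(g·g₀)` on the right coset space. -/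
def rmul (g₀ : G) : RQ H → RQ H :=
  Quotient.map' (fun g => g * g₀) (fun a b hab => by
    rw [QuotientGroup.rightRel_apply] at hab ⊢
    have h2 : b * g₀ * (a * g₀)⁻¹ = b * a⁻¹ := by group
    rw [h2]; exact hab)

/-- `s : H\G → G` is a section of the right cosets with `s(H) = e`. -/
def IsSection (s : RQ H → G) : Prop :=
  (∀ θ : RQ H, Quotient.mk'' (s θ) = θ) ∧ s (Quotient.mk'' 1) = 1

variable {X : Type*}

/-- The co-induced action `α^{H\G}` of `G` on `X_H^G = ∏_{θ ∈ H\G} X`, relative to a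
section `s` of the right cosets:
`(α^{H\G}_{g₀} f)(Hg) = α_{s(Hg)·g₀·s(Hg·g₀)⁻¹} (f (Hg·g₀))`.
(When `s` is a genuine section the element `s(Hg)·g₀·s(Hg·g₀)⁻¹` always lies in `H`,
so the `else` branch is never taken.) -/
noncomputable def coindAct (α : ↥H → X → X) (s : RQ H → G) (g₀ : G)
    (f : RQ H → X) : RQ H → X := fun θ =>
  if h : s θ * g₀ * (s (rmul H g₀ θ))⁻¹ ∈ H then
    α ⟨s θ * g₀ * (s (rmul H g₀ θ))⁻¹, h⟩ (f (rmul H g₀ θ))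
  else f (rmul H g₀ θ)

end CoInd

section PatternEntropy

variable {G X : Type*}

lemma joinPull_sUnion {α : G → X → X} {𝒰 : Set (Set X)} (h : ⋃₀ 𝒰 = Set.univ) {n : ℕ}
    (g : Fin n → G) : ⋃₀ joinPull α 𝒰 g = Set.univ := by
  refine Set.eq_univ_of_forall fun x => ?_
  have hx : ∀ i, ∃ U ∈ 𝒰, α (g i) x ∈ U := fun i =>
    Set.mem_sUnion.1 (h ▸ Set.mem_univ (α (g i) x))
  choose U hU hxU using hx
  exact ⟨⋂ i, α (g i) ⁻¹' U i, ⟨U, hU, rfl⟩, Set.mem_iInter.2 hxU⟩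

lemma joinPull_mono (α : G → X → X) {𝒰 𝒱 : Set (Set X)} (h : 𝒰 ⊆ 𝒱) {n : ℕ}
    (g : Fin n → G) : joinPull α 𝒰 g ⊆ joinPull α 𝒱 g := by
  rintro V ⟨U, hU, rfl⟩
  exact ⟨U, fun i => h (hU i), rfl⟩

lemma IsOpenCover.joinPull [TopologicalSpace X] {α : G → X → X} (hα : ∀ g, Continuous (α g))
    {𝒰 : Set (Set X)} (h : IsOpenCover 𝒰) {n : ℕ} (g : Fin n → G) :
    IsOpenCover (joinPull α 𝒰 g) := by
  refine ⟨?_, joinPull_sUnion h.2 g⟩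
  rintro V ⟨U, hU, rfl⟩
  exact isOpen_iInter_of_finite fun i => (h.1 _ (hU i)).preimage (hα _)

lemma IsOpenCover.exists_finset [TopologicalSpace X] [CompactSpace X] {𝒰 : Set (Set X)}
    (h : IsOpenCover 𝒰) :
    ∃ F : Finset (Set X), ↑F ⊆ 𝒰 ∧ ⋃₀ (F : Set (Set X)) = Set.univ := by
  obtain ⟨F, hF⟩ := isCompact_univ.elim_finite_subcover (fun U : 𝒰 => (U : Set X))
    (fun U => h.1 U U.2) (by rw [← Set.sUnion_eq_iUnion, h.2])
  refine ⟨F.image Subtype.val, by simp, Set.eq_univ_of_forall fun x => ?_⟩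
  obtain ⟨U, hU, hx⟩ := Set.mem_iUnion₂.1 (hF (Set.mem_univ x))
  exact ⟨U, Finset.mem_coe.2 (Finset.mem_image_of_mem _ hU), hx⟩

lemma coverN_le_card {𝒰 : Set (Set X)} {F : Finset (Set X)} (hF : ↑F ⊆ 𝒰)
    (hcov : ⋃₀ (F : Set (Set X)) = Set.univ) : coverN 𝒰 ≤ F.card :=
  Nat.sInf_le ⟨F, hF, rfl, hcov⟩

lemma coverN_le_of_refines [TopologicalSpace X] [CompactSpace X] {𝒰 𝒱 : Set (Set X)}
    (h𝒱 : IsOpenCover 𝒱) (href : ∀ V ∈ 𝒱, ∃ U ∈ 𝒰, V ⊆ U) : coverN 𝒰 ≤ coverN 𝒱 := by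
  obtain ⟨F₀, hF₀, hcov₀⟩ := h𝒱.exists_finset
  obtain ⟨F, hF, hcard, hcov⟩ := Nat.sInf_mem (s := {n : ℕ | ∃ F : Finset (Set X), ↑F ⊆ 𝒱 ∧
    F.card = n ∧ ⋃₀ (F : Set (Set X)) = Set.univ}) ⟨_, F₀, hF₀, rfl, hcov₀⟩
  choose! f hf hsub using href
  have himage : coverN 𝒰 ≤ (F.image f).card := by
    refine coverN_le_card ?_ (Set.eq_univ_of_forall fun x => ?_)
    · intro U hU
      obtain ⟨V, hV, rfl⟩ := Finset.mem_image.1 (Finset.mem_coe.1 hU)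
      exact hf V (hF hV)
    · obtain ⟨V, hV, hx⟩ := Set.mem_sUnion.1 (hcov ▸ Set.mem_univ x)
      exact ⟨f V, Finset.mem_coe.2 (Finset.mem_image_of_mem f hV), hsub V (hF hV) hx⟩
  exact himage.trans (Finset.card_image_le.trans hcard.le)

lemma coverN_joinPull_le_pow (α : G → X → X) {𝒰 : Set (Set X)} {F : Finset (Set X)}
    (hF : ↑F ⊆ 𝒰) (hcov : ⋃₀ (F : Set (Set X)) = Set.univ) {n : ℕ} (g : Fin n → G) :
    coverN (joinPull α 𝒰 g) ≤ F.card ^ n := by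
  let K : Finset (Set X) :=
    (Fintype.piFinset fun _ : Fin n => F).image fun U => ⋂ i, α (g i) ⁻¹' U i
  have hK : (K : Set (Set X)) = joinPull α F g := by
    ext V
    simp [K, joinPull, eq_comm]
  calc coverN (joinPull α 𝒰 g) ≤ K.card :=
        coverN_le_card (hK ▸ joinPull_mono α hF g) (hK ▸ joinPull_sUnion hcov g)
    _ ≤ (Fintype.piFinset fun _ : Fin n => F).card := Finset.card_image_le
    _ = F.card ^ n := by simp

lemma coverN_joinPull_le_patN [TopologicalSpace X] [CompactSpace X] (α : G → X → X)
    {𝒰 : Set (Set X)} (h : IsOpenCover 𝒰) {n : ℕ} (g : Fin n → G) :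
    coverN (joinPull α 𝒰 g) ≤ patN α 𝒰 n := by
  obtain ⟨F, hF, hcov⟩ := h.exists_finset
  refine le_csSup ⟨F.card ^ n, ?_⟩ ⟨g, rfl⟩
  rintro _ ⟨g', rfl⟩
  exact coverN_joinPull_le_pow α hF hcov g'

lemma patN_le [Nonempty G] {α : G → X → X} {𝒰 : Set (Set X)} {n m : ℕ}
    (h : ∀ g : Fin n → G, coverN (joinPull α 𝒰 g) ≤ m) : patN α 𝒰 n ≤ m := by
  refine csSup_le ⟨_, fun _ => Classical.arbitrary G, rfl⟩ ?_
  rintro _ ⟨g, rfl⟩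
  exact h g

lemma patEntCover_mono {G' : Type*} {α : G → X → X} {β : G' → X → X} {𝒰 𝒱 : Set (Set X)}
    (h : ∀ n, patN α 𝒰 n ≤ patN β 𝒱 n) : patEntCover α 𝒰 ≤ patEntCover β 𝒱 := by
  refine limsup_le_limsup (Eventually.of_forall fun n => ENNReal.ofReal_le_ofReal ?_)
  refine div_le_div_of_nonneg_right ?_ n.cast_nonneg
  rcases Nat.eq_zero_or_pos (patN α 𝒰 n) with h0 | hpos
  · simpa [h0] using Real.log_natCast_nonneg _
  · exact Real.log_le_log (by exact_mod_cast hpos) (by exact_mod_cast h n)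

lemma patEnt_restrict_le [Group G] [TopologicalSpace X] [CompactSpace X] (α : G → X → X)
    (H : Subgroup G) : patEnt (fun (h : ↥H) (x : X) => α ↑h x) ≤ patEnt α :=
  iSup₂_mono fun _ h𝒰 => patEntCover_mono fun _ => patN_le fun g =>
    coverN_joinPull_le_patN α h𝒰 fun i => (g i : G)

lemma exists_transversal [Group G] (H : Subgroup G) [H.FiniteIndex] :
    ∃ (k : ℕ) (t : Fin k → G), ∀ g : G, ∃ j, ∃ h : H, g = t j * h := by
  obtain ⟨k, ⟨e⟩⟩ := Finite.exists_equiv_fin (G ⧸ H)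
  refine ⟨k, fun j => (e.symm j).out, fun g => ?_⟩
  obtain ⟨h, hh⟩ := QuotientGroup.mk_out_eq_mul H g
  exact ⟨e g, h⁻¹, by simp [hh]⟩

lemma patEnt_le_restrict [Group G] [TopologicalSpace X] [CompactSpace X] {α : G → X → X}
    (hα : IsActionBy α) (H : Subgroup G) [H.FiniteIndex] :
    patEnt α ≤ patEnt (fun (h : ↥H) (x : X) => α ↑h x) := by
  obtain ⟨k, t, ht⟩ := exists_transversal H
  choose j h hjh using ht
  refine iSup₂_le fun 𝒰 h𝒰 => ?_
  have h𝒱 : IsOpenCover (joinPull α 𝒰 t) := IsOpenCover.joinPull hα.2.2 h𝒰 t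
  refine le_trans (patEntCover_mono fun n => patN_le fun g => ?_)
    (le_iSup₂_of_le (joinPull α 𝒰 t) h𝒱 le_rfl)
  refine le_trans (coverN_le_of_refines
    (IsOpenCover.joinPull (fun i : H => hα.2.2 i) h𝒱 fun i => h (g i)) ?_)
    (coverN_joinPull_le_patN _ h𝒱 fun i => h (g i))
  rintro _ ⟨V, hV, rfl⟩
  choose U hU hVU using hV
  refine ⟨_, ⟨fun i => U i (j (g i)), fun i => hU i _, rfl⟩, Set.iInter_mono fun i x hx => ?_⟩
  rw [Set.mem_preimage, hVU i, Set.mem_iInter] at hx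
  rw [Set.mem_preimage, hjh (g i), hα.2.1]
  exact hx (j (g i))

end PatternEntropy

/-- Huang–Ye: if `[G:H] < ∞` then
`h*_top(X,G,α) = h*_top(X,H,α|_H)`. -/
theorem maximal_pattern_entropy_finiteIndex_subgroup
    {G X : Type*} [Group G] [Countable G] [Infinite G] [MetricSpace X] [CompactSpace X]
    (α : G → X → X) (hα : IsActionBy α) (H : Subgroup G) (hH : H.index ≠ 0) :
    patEnt α = patEnt (fun (h : ↥H) (x : X) => α ↑h x) := by
  have : H.FiniteIndex := ⟨hH⟩
  exact le_antisymm (patEnt_le_restrict hα H) (patEnt_restrict_le α H)
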